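/- Let f : K → L be a morphism of augmented directed complexes between simple augmented directed complexes K and L, and let a be an n-dimensional basis element of K. Then fa, as an element of L_n*, corresponds to a separated sequence of n-dimensional basis elements of L; in particular fa is a sum of distinct basis elements of L. -/

import Mathlib

/-- The data of a globular set: a dimension function together with
source (`src`) and target (`tgt`) operations. -/
structure GlobData where
  X : Type
  dim : X → ℕ
  src : X → X
  tgt : X → X

namespace GlobData

/-- The generating relation: `∂⁻y < y` (for `|y| > 0`) and `x < ∂⁺x` (for `|x| > 0`). -/
def rel (G : GlobData) (x y : G.X) : Prop :=
  (0 < G.dim y ∧ x = G.src y) ∨ (0 < G.dim x ∧ y = G.tgt x)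

/-- The transitive closure of the generating relation. -/
def lt (G : GlobData) : G.X → G.X → Prop :=
  Relation.TransGen G.rel

def le (G : GlobData) (x y : G.X) : Prop :=
  G.lt x y ∨ x = y

end GlobData

/-- A simple globular set: nonempty, finite, the source/target operations lower
dimension by one, the globular identities hold, and the transitive closure of the
generating relation is a (strict) total ordering. -/
def IsSimpleGlobular (G : GlobData) : Prop :=
  Nonempty G.X ∧ Finite G.X ∧
  (∀ x, 0 < G.dim x → G.dim (G.src x) + 1 = G.dim x) ∧
  (∀ x, 0 < G.dim x → G.dim (G.tgt x) + 1 = G.dim x) ∧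
  (∀ x, 2 ≤ G.dim x → G.src (G.src x) = G.src (G.tgt x)) ∧
  (∀ x, 2 ≤ G.dim x → G.tgt (G.src x) = G.tgt (G.tgt x)) ∧
  (∀ x, ¬ G.lt x x) ∧
  (∀ x y, G.lt x y ∨ x = y ∨ G.lt y x)

/-- The data of an augmented directed complex with basis: a graded set `B` of basis
elements, the boundary `d b` of each basis element (a finitely supported `ℤ`-linear
combination of basis elements), and the augmentation `eps b` of each basis element
(only relevant in dimension `0`).  The chain group `K_q` is the free abelian group
on the basis elements of dimension `q` and the distinguished submonoid `K_q*` is the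
set of nonnegative combinations of such basis elements. -/
structure PreADC where
  B : Type
  dim : B → ℕ
  d : B → (B →₀ ℤ)
  eps : B → ℤ

namespace PreADC

/-- The positive part `∂⁺x` of a chain. -/
noncomputable def posPart {B : Type} (x : B →₀ ℤ) : B →₀ ℤ :=
  Finsupp.mapRange (fun c => max c 0) (by simp) x

/-- The negative part `∂⁻x` of a chain. -/
noncomputable def negPart {B : Type} (x : B →₀ ℤ) : B →₀ ℤ :=
  Finsupp.mapRange (fun c => max (-c) 0) (by simp) x

/-- The boundary of a chain, extended linearly from basis elements. -/
noncomputable def bnd (K : PreADC) (x : K.B →₀ ℤ) : K.B →₀ ℤ :=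
  x.sum fun a c => c • K.d a

/-- The augmentation of a chain (applied to its degree-zero part). -/
noncomputable def aug (K : PreADC) (x : K.B →₀ ℤ) : ℤ :=
  x.sum fun a c => if K.dim a = 0 then c * K.eps a else 0

/-- `∂⁻` of a chain. -/
noncomputable def dMinus (K : PreADC) (x : K.B →₀ ℤ) : K.B →₀ ℤ :=
  negPart (K.bnd x)

/-- `∂⁺` of a chain. -/
noncomputable def dPlus (K : PreADC) (x : K.B →₀ ℤ) : K.B →₀ ℤ :=
  posPart (K.bnd x)

/-- The axioms of an augmented directed complex with basis: the boundary of a basis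
element lowers dimension by exactly one (and vanishes in dimension `0`), `∂∂ = 0`,
and `ε∂ = 0`. -/
def IsADC (K : PreADC) : Prop :=
  (∀ b, K.dim b = 0 → K.d b = 0) ∧
  (∀ b a, (K.d b) a ≠ 0 → K.dim a + 1 = K.dim b) ∧
  (∀ b, K.bnd (K.d b) = 0) ∧
  (∀ b, K.dim b = 1 → K.aug (K.d b) = 0)

/-- The basis is unital: `ε((∂⁻)^{|b|} b) = ε((∂⁺)^{|b|} b) = 1` for all basis elements. -/
def Unital (K : PreADC) : Prop :=
  ∀ b : K.B,
    K.aug ((K.dMinus)^[K.dim b] (Finsupp.single b 1)) = 1 ∧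
    K.aug ((K.dPlus)^[K.dim b] (Finsupp.single b 1)) = 1

/-- The basis is loop-free: for each `q` there is a (strict) partial ordering `r`
such that `a r b` whenever `a` is a term of `(∂⁻)^{|b|-q} b` with `|b| > q`, or `b`
is a term of `(∂⁺)^{|a|-q} a` with `|a| > q`. -/
def LoopFree (K : PreADC) : Prop :=
  ∀ q : ℕ, ∃ r : K.B → K.B → Prop,
    (∀ a b c, r a b → r b c → r a c) ∧ (∀ a, ¬ r a a) ∧
    (∀ a b, q < K.dim b → ((K.dMinus)^[K.dim b - q] (Finsupp.single b 1)) a ≠ 0 → r a b) ∧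
    (∀ a b, q < K.dim a → ((K.dPlus)^[K.dim a - q] (Finsupp.single a 1)) b ≠ 0 → r a b)

/-- The basis is strongly loop-free: there is a (strict) partial ordering `r` on the
whole basis such that `a r b` whenever `a` is a term of `∂⁻b` or `b` is a term of `∂⁺a`. -/
def StronglyLoopFree (K : PreADC) : Prop :=
  ∃ r : K.B → K.B → Prop,
    (∀ a b c, r a b → r b c → r a c) ∧ (∀ a, ¬ r a a) ∧
    (∀ a b, (negPart (K.d b)) a ≠ 0 → r a b) ∧
    (∀ a b, (posPart (K.d a)) b ≠ 0 → r a b)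

/-- `f` (given by its values on basis elements, extended linearly) is a chain map
preserving the grading and taking sums of basis elements to sums of basis elements
(equivalently `f(K_q*) ⊆ L_q*`). -/
def IsMor (K L : PreADC) (f : K.B → (L.B →₀ ℤ)) : Prop :=
  (∀ b a, (f b) a ≠ 0 → L.dim a = K.dim b) ∧
  (∀ b, ((K.d b).sum fun a c => c • f a) = L.bnd (f b)) ∧
  (∀ b a, 0 ≤ (f b) a)

/-- A morphism of augmented directed complexes: a chain map as in `IsMor` which is
moreover augmentation-preserving. -/
def IsAugMor (K L : PreADC) (f : K.B → (L.B →₀ ℤ)) : Prop :=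
  IsMor K L f ∧ ∀ b, K.dim b = 0 → L.aug (f b) = K.eps b

end PreADC

/-- The simple augmented directed complex generated by a (simple) globular set:
basis the elements of `X`, `∂x = ∂⁺x - ∂⁻x` for positive-dimensional `x`,
and `εx = 1` on zero-dimensional basis elements. -/
noncomputable def GlobData.toADC (G : GlobData) : PreADC where
  B := G.X
  dim := G.dim
  d := fun b =>
    if 0 < G.dim b then
      Finsupp.single (G.tgt b) 1 - Finsupp.single (G.src b) 1
    else 0
  eps := fun _ => 1

/-- An ordered sequence of `n`-dimensional basis elements. -/
def OrderedSeq (G : GlobData) (n : ℕ) (l : List G.X) : Prop :=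
  (∀ a ∈ l, G.dim a = n) ∧ l.Chain' G.le

/-- A separated sequence of `n`-dimensional basis elements: ordered, and each
consecutive pair of terms encloses a basis element of dimension `< n`. -/
def SeparatedSeq (G : GlobData) (n : ℕ) (l : List G.X) : Prop :=
  OrderedSeq G n l ∧ l.Chain' (fun a b => ∃ c, G.lt a c ∧ G.lt c b ∧ G.dim c < n)

/-- The element of `K_n*` corresponding to a sequence of basis elements:
the sum of its terms. -/
noncomputable def chainOf (G : GlobData) (l : List G.X) : G.X →₀ ℤ :=
  (l.map fun a => Finsupp.single a (1 : ℤ)).sum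

/-- The partial ordering of separated sequences of `n`-dimensional basis elements:
same length, termwise `≤`, and all basis elements strictly between corresponding
terms have dimension `≥ n`. -/
def sepLe (G : GlobData) (n : ℕ) (l l' : List G.X) : Prop :=
  List.Forall₂ (fun a a' => G.le a a' ∧ ∀ c, G.lt a c → G.lt c a' → n ≤ G.dim c) l l'

/-- No element of dimension `< n` lies strictly between `x` and `y`, in either order. -/
def GlobData.Near (G : GlobData) (n : ℕ) (x y : G.X) : Prop :=
  ∀ z, G.dim z < n → ¬ (G.lt x z ∧ G.lt z y) ∧ ¬ (G.lt y z ∧ G.lt z x)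

/-- The coefficients of `c` sum to at most `1` over each set of pairwise near elements. -/
def Sparse (H : GlobData) (n : ℕ) (c : H.X →₀ ℤ) : Prop :=
  ∀ S : Finset H.X, (∀ x ∈ S, ∀ y ∈ S, H.Near n x y) → ∑ x ∈ S, c x ≤ 1

namespace GlobData

variable {G : GlobData}

theorem lt_trans' {x y z : G.X} (h : G.lt x y) (h' : G.lt y z) : G.lt x z :=
  Relation.TransGen.trans h h'

theorem src_lt {x : G.X} (h : 0 < G.dim x) : G.lt (G.src x) x :=
  Relation.TransGen.single (Or.inl ⟨h, rfl⟩)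

theorem lt_tgt {x : G.X} (h : 0 < G.dim x) : G.lt x (G.tgt x) :=
  Relation.TransGen.single (Or.inr ⟨h, rfl⟩)

end GlobData

namespace IsSimpleGlobular

variable {G : GlobData}

theorem wellFounded_lt (hG : IsSimpleGlobular G) : WellFounded G.lt := by
  obtain ⟨_, hfin, _, _, _, _, hirr, _⟩ := hG
  have : IsTrans G.X G.lt := ⟨fun _ _ _ => GlobData.lt_trans'⟩
  have : Std.Irrefl G.lt := ⟨hirr⟩
  exact Finite.wellFounded_of_trans_of_irrefl G.lt

theorem wellFounded_gt (hG : IsSimpleGlobular G) :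
    WellFounded (fun x y => G.lt y x) := by
  obtain ⟨_, hfin, _, _, _, _, hirr, _⟩ := hG
  have : IsTrans G.X (fun x y => G.lt y x) := ⟨fun _ _ _ h h' => GlobData.lt_trans' h' h⟩
  have : Std.Irrefl (fun x y => G.lt y x) := ⟨hirr⟩
  exact Finite.wellFounded_of_trans_of_irrefl _

theorem dim_le_of_src_lt (hG : IsSimpleGlobular G) (w : G.X) :
    0 < G.dim w → ∀ z, G.lt (G.src w) z → G.lt z w → G.dim w ≤ G.dim z := by
  induction w using hG.wellFounded_lt.induction with
  | _ w ih =>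
  intro hw z h1 h2
  obtain ⟨_, _, hs, ht, hss, _, hirr, htot⟩ := hG
  have key : ∃ x, (z = x ∨ G.lt z x) ∧ G.rel x w := by
    obtain ⟨x, hx, hr⟩ := Relation.TransGen.tail'_iff.1 h2
    rcases Relation.reflTransGen_iff_eq_or_transGen.1 hx with h | h
    · exact ⟨x, Or.inl h.symm, hr⟩
    · exact ⟨x, Or.inr h, hr⟩
  obtain ⟨x, hzx, ⟨_, rfl⟩ | ⟨hx0, rfl⟩⟩ := key
  · rcases hzx with rfl | h
    · exact (hirr _ h1).elim
    · exact (hirr _ (GlobData.lt_trans' h1 h)).elim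
  · have hdt := ht x hx0
    have hds := hs x hx0
    rcases hzx with rfl | hzx
    · omega
    rcases htot z (G.src x) with h | rfl | h
    · have := ih (G.src x)
        (GlobData.lt_trans' (GlobData.src_lt hx0) (GlobData.lt_tgt hx0)) (by omega) z
        (by rw [hss x (by omega)]; exact h1) h
      omega
    · omega
    · have := ih x (GlobData.lt_tgt hx0) hx0 z h hzx
      omega

theorem dim_le_of_lt_tgt (hG : IsSimpleGlobular G) (w : G.X) :
    0 < G.dim w → ∀ z, G.lt w z → G.lt z (G.tgt w) → G.dim w ≤ G.dim z := by
  induction w using hG.wellFounded_gt.induction with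
  | _ w ih =>
  intro hw z h1 h2
  obtain ⟨_, _, hs, ht, _, htt, hirr, htot⟩ := hG
  have key : ∃ x, (z = x ∨ G.lt x z) ∧ G.rel w x := by
    obtain ⟨x, hr, hx⟩ := Relation.TransGen.head'_iff.1 h1
    rcases Relation.reflTransGen_iff_eq_or_transGen.1 hx with h | h
    · exact ⟨x, Or.inl h, hr⟩
    · exact ⟨x, Or.inr h, hr⟩
  obtain ⟨x, hzx, ⟨hx0, rfl⟩ | ⟨_, rfl⟩⟩ := key
  · have hdt := ht x hx0
    have hds := hs x hx0
    rcases hzx with rfl | hzx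
    · omega
    rcases htot z (G.tgt x) with h | rfl | h
    · have := ih x (GlobData.src_lt hx0) hx0 z hzx h
      omega
    · omega
    · have := ih (G.tgt x)
        (GlobData.lt_trans' (GlobData.src_lt hx0) (GlobData.lt_tgt hx0)) (by omega) z h
        (by rw [← htt x (by omega)]; exact h2)
      omega
  · rcases hzx with rfl | h
    · exact (hirr _ h2).elim
    · exact (hirr _ (GlobData.lt_trans' h h2)).elim

/-- An element near `y` has its source below `y` and its target above `y`. -/
theorem src_lt_and_lt_tgt_of_near (hG : IsSimpleGlobular G) {w y : G.X} (hw : 0 < G.dim w)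
    (hy : G.dim y = G.dim w) (h : G.Near (G.dim w) w y) :
    G.lt (G.src w) y ∧ G.lt y (G.tgt w) := by
  obtain ⟨_, _, hs, ht, _, _, _, htot⟩ := hG
  have hds := hs w hw
  have hdt := ht w hw
  constructor
  · rcases htot (G.src w) y with h1 | h1 | h1
    · exact h1
    · rw [h1] at hds; omega
    · exact ((h (G.src w) (by omega)).2 ⟨h1, GlobData.src_lt hw⟩).elim
  · rcases htot y (G.tgt w) with h1 | h1 | h1
    · exact h1
    · rw [← h1] at hdt; omega
    · exact ((h (G.tgt w) (by omega)).1 ⟨GlobData.lt_tgt hw, h1⟩).elim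

theorem near_src_of_near (hG : IsSimpleGlobular G) {n : ℕ} {w y : G.X} (hw : G.dim w = n + 1)
    (h : G.Near n w y) : G.Near n (G.src w) y := by
  have h0 : 0 < G.dim w := by omega
  have hA := hG.dim_le_of_src_lt w h0
  obtain ⟨_, _, hs, ht, _, _, _, htot⟩ := hG
  refine fun z hz => ⟨fun ⟨h1, h2⟩ => ?_, fun ⟨h1, h2⟩ =>
    (h z hz).2 ⟨h1, GlobData.lt_trans' h2 (GlobData.src_lt h0)⟩⟩
  rcases htot z w with h3 | rfl | h3
  · have := hA z h1 h3
    omega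
  · omega
  · exact (h z hz).1 ⟨h3, h2⟩

/-- If `∂⁺w < y` is near `y`, then so is `∂⁻w`. -/
theorem near_src_of_near_tgt (hG : IsSimpleGlobular G) {n : ℕ} {w y : G.X}
    (hw : G.dim w = n + 1) (hlt : G.lt (G.tgt w) y) (h : G.Near n (G.tgt w) y) :
    G.Near n (G.src w) y := by
  have h0 : 0 < G.dim w := by omega
  have hA := hG.dim_le_of_lt_tgt w h0
  refine hG.near_src_of_near hw ?_
  obtain ⟨_, _, hs, ht, _, _, hirr, htot⟩ := hG
  have hdt := ht w h0
  refine fun z hz => ⟨fun ⟨h1, h2⟩ => ?_, fun ⟨h1, h2⟩ => hirr _ (GlobData.lt_trans' hlt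
    (GlobData.lt_trans' h1 (GlobData.lt_trans' h2 (GlobData.lt_tgt h0))))⟩
  rcases htot z (G.tgt w) with h3 | rfl | h3
  · have := hA z h1 h3
    omega
  · omega
  · exact (h z hz).1 ⟨h3, h2⟩

theorem antisymm_le (hG : IsSimpleGlobular G) {x y : G.X} (h : G.le x y) (h' : G.le y x) :
    x = y := by
  obtain ⟨_, _, _, _, _, _, hirr, _⟩ := hG
  rcases h with h | h
  · rcases h' with h' | h'
    · exact (hirr _ (GlobData.lt_trans' h h')).elim
    · exact h'.symm
  · exact h

end IsSimpleGlobular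

theorem GlobData.sum_bnd_toADC (H : GlobData) {c b : H.X →₀ ℤ} (hb : H.toADC.bnd c = b)
    (T : Finset H.X) [DecidableEq H.X] (hc : ∀ a, c a ≠ 0 → 0 < H.dim a) :
    ∑ x ∈ T, b x = ∑ a ∈ c.support,
      c a * ((if H.tgt a ∈ T then 1 else 0) - (if H.src a ∈ T then 1 else 0)) := by
  have h : ∀ x, b x = ∑ a ∈ c.support, c a *
      (Finsupp.single (H.tgt a) (1 : ℤ) - Finsupp.single (H.src a) 1 : H.X →₀ ℤ) x := by
    intro x
    have hd : b = c.sum fun a k => k • (if 0 < H.dim a then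
      Finsupp.single (H.tgt a) (1 : ℤ) - Finsupp.single (H.src a) 1 else 0) := hb.symm
    rw [hd, Finsupp.sum, Finsupp.finsetSum_apply]
    refine Finset.sum_congr rfl fun a ha => ?_
    rw [if_pos (hc a (Finsupp.mem_support_iff.1 ha)), Finsupp.smul_apply, smul_eq_mul]
  rw [Finset.sum_congr rfl fun x _ => h x, Finset.sum_comm]
  refine Finset.sum_congr rfl fun a _ => ?_
  rw [← Finset.mul_sum]
  congr 1
  simp only [Finsupp.sub_apply, Finset.sum_sub_distrib,
    Finsupp.single_apply, Finset.sum_ite_eq]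

theorem Sparse.of_bnd_eq_sub {H : GlobData} (hH : IsSimpleGlobular H) {n : ℕ}
    {c u v : H.X →₀ ℤ} (hc : ∀ a, 0 ≤ c a) (hdim : ∀ a, c a ≠ 0 → H.dim a = n + 1)
    (hu : ∀ a, 0 ≤ u a) (hv : Sparse H n v) (hbnd : H.toADC.bnd c = u - v) :
    Sparse H (n + 1) c := by
  classical
  intro S hS
  by_cases hne : ∃ y ∈ S, H.dim y = n + 1
  swap
  · rw [Finset.sum_eq_zero fun x hx => by_contra fun h => hne ⟨x, hx, hdim x h⟩]
    exact zero_le_one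
  obtain ⟨y, hyS, hy⟩ := hne
  have : Finite H.X := hH.2.1
  have := Fintype.ofFinite H.X
  have hirr := hH.2.2.2.2.2.2.1
  have hds := hH.2.2.1
  set T : Finset H.X :=
    Finset.univ.filter fun x => H.dim x = n ∧ H.lt x y ∧ H.Near n x y with hTdef
  have hmem : ∀ x, x ∈ T ↔ H.dim x = n ∧ H.lt x y ∧ H.Near n x y := by simp [hTdef]
  have hvT : ∑ x ∈ T, v x ≤ 1 := by
    refine hv T fun x hx x' hx' z hz => ?_
    rw [hmem] at hx hx'
    exact ⟨fun ⟨h1, h2⟩ => (hx.2.2 z hz).1 ⟨h1, GlobData.lt_trans' h2 hx'.2.1⟩,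
      fun ⟨h1, h2⟩ => (hx'.2.2 z hz).1 ⟨h1, GlobData.lt_trans' h2 hx.2.1⟩⟩
  have huT : 0 ≤ ∑ x ∈ T, u x := Finset.sum_nonneg fun x _ => hu x
  have hsum := H.sum_bnd_toADC hbnd T fun a ha => by rw [hdim a ha]; omega
  simp only [Finsupp.sub_apply, Finset.sum_sub_distrib] at hsum
  set g : H.X → ℤ := fun a =>
    c a * ((if H.tgt a ∈ T then 1 else 0) - (if H.src a ∈ T then 1 else 0)) with hg
  have hsupp : ∑ a ∈ c.support, g a = ∑ a, g a :=
    Finset.sum_subset (Finset.subset_univ _) fun a _ ha => by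
      simp [hg, Finsupp.notMem_support_iff.1 ha]
  have hg0 : ∀ a, g a ≤ 0 := by
    intro a
    by_cases ha : c a = 0
    · simp [hg, ha]
    have hda := hdim a ha
    refine mul_nonpos_of_nonneg_of_nonpos (hc a) ?_
    by_cases ht : H.tgt a ∈ T
    · have hs : H.src a ∈ T := by
        rw [hmem] at ht ⊢
        have h0 : 0 < H.dim a := by omega
        refine ⟨by have := hds a h0; omega, ?_, hH.near_src_of_near_tgt hda ht.2.1 ht.2.2⟩
        exact GlobData.lt_trans' (GlobData.src_lt h0)
          (GlobData.lt_trans' (GlobData.lt_tgt h0) ht.2.1)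
      simp [ht, hs]
    · split_ifs <;> simp
  have hgS : ∀ a ∈ S, g a = -c a := by
    intro a haS
    by_cases ha : c a = 0
    · simp [hg, ha]
    have hda := hdim a ha
    have h0 : 0 < H.dim a := by omega
    have hnear := hS a haS y hyS
    obtain ⟨h1, h2⟩ :=
      hH.src_lt_and_lt_tgt_of_near h0 (hy.trans hda.symm) (hda.symm ▸ hnear)
    have hs : H.src a ∈ T := by
      rw [hmem]
      exact ⟨by have := hds a h0; omega, h1,
        hH.near_src_of_near hda fun z hz => hnear z (by omega)⟩
    have ht : H.tgt a ∉ T := by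
      rw [hmem]
      exact fun h => hirr _ (GlobData.lt_trans' h2 h.2.1)
    simp [hg, hs, ht]
  have hle : ∑ a, g a ≤ ∑ a ∈ S, g a := by
    rw [← Finset.sum_sdiff (Finset.subset_univ S)]
    linarith [Finset.sum_nonpos fun a (_ : a ∈ Finset.univ \ S) => hg0 a]
  rw [Finset.sum_congr rfl hgS, Finset.sum_neg_distrib] at hle
  linarith

theorem PreADC.IsAugMor.sparse {G H : GlobData} (hG : IsSimpleGlobular G)
    (hH : IsSimpleGlobular H) {f : G.X → (H.X →₀ ℤ)}
    (hf : PreADC.IsAugMor G.toADC H.toADC f) (n : ℕ) :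
    ∀ a : G.X, G.dim a = n → Sparse H n (f a) := by
  obtain ⟨⟨hdim, hbnd, hnn⟩, haug⟩ := hf
  change ∀ b a, f b a ≠ 0 → H.dim a = G.dim b at hdim
  change ∀ b a, 0 ≤ f b a at hnn
  induction n with
  | zero =>
    intro a ha S _
    have h1 : ((f a).sum fun x k => if H.dim x = 0 then k * 1 else 0) = 1 := haug a ha
    have h2 : ∑ x ∈ (f a).support, f a x = 1 := by
      rw [← h1, Finsupp.sum]
      refine Finset.sum_congr rfl fun x hx => ?_
      rw [if_pos (by rw [hdim a x (Finsupp.mem_support_iff.1 hx), ha]), mul_one]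
    classical
    rw [← h2, ← Finset.sum_subset (Finset.inter_subset_left (s₂ := (f a).support)) fun x hx hx' =>
      Finsupp.notMem_support_iff.1 fun h => hx' (Finset.mem_inter.2 ⟨hx, h⟩)]
    exact Finset.sum_le_sum_of_subset_of_nonneg Finset.inter_subset_right fun x _ _ => hnn a x
  | succ n ih =>
    intro a ha
    have h0 : 0 < G.dim a := by omega
    have hs := hG.2.2.1 a h0
    refine Sparse.of_bnd_eq_sub hH (u := f (G.tgt a)) (v := f (G.src a)) (hnn a)
      (fun x hx => (hdim a x hx).trans ha) (hnn _) (ih _ (by omega)) ?_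
    have hd : G.toADC.d a = Finsupp.single (G.tgt a) 1 - Finsupp.single (G.src a) 1 :=
      if_pos h0
    have key : ((Finsupp.single (G.tgt a) (1 : ℤ) - Finsupp.single (G.src a) 1).sum
        fun x k => k • f x) = f (G.tgt a) - f (G.src a) := by
      rw [Finsupp.sum_sub_index fun _ _ _ => sub_smul _ _ _]
      simp
    rw [← hbnd a, hd]
    exact key

theorem Sparse.exists_separatedSeq {H : GlobData} (hH : IsSimpleGlobular H) {n : ℕ}
    {c : H.X →₀ ℤ} (hc : ∀ a, 0 ≤ c a) (hdim : ∀ a, c a ≠ 0 → H.dim a = n)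
    (h : Sparse H n c) :
    ∃ l : List H.X, SeparatedSeq H n l ∧ l.Nodup ∧ chainOf H l = c := by
  classical
  have htot := hH.2.2.2.2.2.2.2
  have hirr := hH.2.2.2.2.2.2.1
  have : IsTrans H.X H.le := ⟨by
    rintro a b d (h1 | rfl) (h2 | rfl)
    exacts [Or.inl (GlobData.lt_trans' h1 h2), Or.inl h1, Or.inl h2, Or.inr rfl]⟩
  have : Std.Antisymm H.le := ⟨fun _ _ => hH.antisymm_le⟩
  have : Std.Total H.le := ⟨fun a b => by
    rcases htot a b with h | h | h
    exacts [Or.inl (Or.inl h), Or.inl (Or.inr h), Or.inr (Or.inl h)]⟩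
  have hpos : ∀ a ∈ c.support, 1 ≤ c a := fun a ha =>
    lt_of_le_of_ne (hc a) (Finsupp.mem_support_iff.1 ha).symm
  have hone : ∀ a ∈ c.support, c a = 1 := by
    intro a ha
    refine le_antisymm ?_ (hpos a ha)
    have := h {a} (by
      simp only [Finset.mem_singleton]
      rintro x rfl y rfl z -
      exact ⟨fun h => hirr _ (GlobData.lt_trans' h.1 h.2),
        fun h => hirr _ (GlobData.lt_trans' h.1 h.2)⟩)
    simpa using this
  have hpair : (c.support.sort H.le).Pairwise H.le := Finset.pairwise_sort _ _
  have hnodup : (c.support.sort H.le).Nodup := Finset.sort_nodup _ _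
  have hmem : ∀ a, a ∈ c.support.sort H.le ↔ a ∈ c.support := fun a => Finset.mem_sort _
  have hsep : ∀ a ∈ c.support, ∀ b ∈ c.support, H.le a b → a ≠ b →
      ∃ z, H.lt a z ∧ H.lt z b ∧ H.dim z < n := by
    intro a ha b hb hab hne
    by_contra hno
    have hlt : H.lt a b := hab.resolve_right hne
    have := h {a, b} (by
      simp only [Finset.mem_insert, Finset.mem_singleton]
      rintro x (rfl | rfl) y (rfl | rfl) z hz
      · exact ⟨fun h => hirr _ (GlobData.lt_trans' h.1 h.2),
          fun h => hirr _ (GlobData.lt_trans' h.1 h.2)⟩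
      · exact ⟨fun h => hno ⟨z, h.1, h.2, hz⟩,
          fun h => hirr _ (GlobData.lt_trans' hlt (GlobData.lt_trans' h.1 h.2))⟩
      · exact ⟨fun h => hirr _ (GlobData.lt_trans' hlt (GlobData.lt_trans' h.1 h.2)),
          fun h => hno ⟨z, h.1, h.2, hz⟩⟩
      · exact ⟨fun h => hirr _ (GlobData.lt_trans' h.1 h.2),
          fun h => hirr _ (GlobData.lt_trans' h.1 h.2)⟩)
    rw [Finset.sum_pair hne, hone a ha, hone b hb] at this
    omega
  refine ⟨c.support.sort H.le, ⟨⟨fun a ha => hdim a ?_, hpair.isChain⟩, ?_⟩, hnodup, ?_⟩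
  · exact Finsupp.mem_support_iff.1 ((hmem a).1 ha)
  · exact ((hpair.and hnodup).imp_of_mem fun ha hb hab =>
      hsep _ ((hmem _).1 ha) _ ((hmem _).1 hb) hab.1 hab.2).isChain
  · have : chainOf H (c.support.sort H.le) = ∑ a ∈ c.support, Finsupp.single a (1 : ℤ) := by
      rw [chainOf, ← List.sum_toFinset _ hnodup, Finset.sort_toFinset]
    rw [this]
    conv_rhs => rw [← Finsupp.sum_single c, Finsupp.sum]
    exact Finset.sum_congr rfl fun a ha => by rw [hone a ha]

/-- A morphism of augmented directed complexes between simple augmented directed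
complexes takes each `n`-dimensional basis element to (the element of `L_n*`
corresponding to) a separated sequence of `n`-dimensional basis elements;
in particular to a sum of distinct basis elements. -/
theorem stmt11 (G H : GlobData) (hG : IsSimpleGlobular G) (hH : IsSimpleGlobular H)
    (f : G.X → (H.X →₀ ℤ))
    (hf : PreADC.IsAugMor G.toADC H.toADC f) :
    ∀ a : G.X, ∃ l : List H.X,
      SeparatedSeq H (G.dim a) l ∧ l.Nodup ∧ chainOf H l = f a := by
  exact fun a => Sparse.exists_separatedSeq hH (hf.1.2.2 a) (hf.1.1 a) (hf.sparse hG hH _ a rfl)
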